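/- For all partitions λ, μ, ν, the sequence d ↦ a_{λ+(d), μ+(d)}^{ν+(d)} of Aguiar coefficients, where λ+(d) denotes the partition obtained by adding d to the first part of λ, is eventually constant as d → ∞. -/

import Mathlib

open scoped BigOperators
open scoped Classical

/-- A partition: a finitely supported antitone sequence of natural numbers
(the parts, indexed from 0). -/
def IsPartitionFun (f : ℕ →₀ ℕ) : Prop := ∀ ⦃i j : ℕ⦄, i ≤ j → f j ≤ f i

def Partition' : Type := {f : ℕ →₀ ℕ // IsPartitionFun f}

namespace Partition'

/-- The size `|λ|` of a partition. -/
def size (l : Partition') : ℕ := l.1.sum fun _ v => v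

/-- The number of (nonzero) parts of a partition. -/
def plength (l : Partition') : ℕ := l.1.support.card

noncomputable instance : Add Partition' :=
  ⟨fun l m => ⟨l.1 + m.1, fun i j h => by
    simp only [Finsupp.add_apply]
    exact add_le_add (l.2 h) (m.2 h)⟩⟩

noncomputable instance : SMul ℕ Partition' :=
  ⟨fun d l => ⟨d • l.1, fun i j h => by
    simp only [Finsupp.smul_apply, smul_eq_mul]
    exact Nat.mul_le_mul_left d (l.2 h)⟩⟩

/-- The one-row partition `(m)`. For `m = 0` this is the empty partition. -/
noncomputable def row (m : ℕ) : Partition' :=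
  ⟨Finsupp.single 0 m, by
    intro i j h
    simp only [Finsupp.single_apply]
    split_ifs <;> omega⟩

/-- The two-row partition `(a, b)` (with `b ≤ a`). -/
noncomputable def twoRow (a b : ℕ) (hba : b ≤ a) : Partition' :=
  ⟨Finsupp.single 0 a + Finsupp.single 1 b, by
    intro i j h
    simp only [Finsupp.add_apply, Finsupp.single_apply]
    split_ifs <;> omega⟩

/-- `youngCount n a g` is the number of fixed points of the permutation `g` acting on the
set of functions `Fin n → Fin n` whose fibre over `i` has exactly `a i` elements; i.e. the
value at `g` of the permutation character of `S_n` acting on cosets of the Young subgroup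
attached to the composition `a`. It is `0` if some `a i` is negative. -/
noncomputable def youngCount (n : ℕ) (a : Fin n → ℤ) (g : Equiv.Perm (Fin n)) : ℤ :=
  if ∀ i, 0 ≤ a i then
    (Nat.card {f : Fin n → Fin n //
      f ∘ g = f ∧ ∀ i : Fin n, Nat.card {x : Fin n // f x = i} = (a i).toNat} : ℤ)
  else 0

/-- The irreducible character of the symmetric group `S_n` attached to a partition `l`
of `n`, given by the Jacobi–Trudi determinantal formula
`χ_l = det (h_{l_i - i + j})` expanded over permutations, where `h`-products are the
permutation characters of Young subgroups. (When `size l ≠ n` this is not used.) -/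
noncomputable def irrChar (n : ℕ) (l : Partition') (g : Equiv.Perm (Fin n)) : ℤ :=
  ∑ σ : Equiv.Perm (Fin n), (Equiv.Perm.sign σ : ℤ) *
    youngCount n (fun i => (l.1 i : ℤ) + ((σ i : ℕ) : ℤ) - (i : ℤ)) g

/-- The Kronecker coefficient `g_{λ,μ,ν}`: the multiplicity of the irreducible `S_n`-module
`M_ν` in `M_λ ⊗ M_μ` (for `|λ| = |μ| = |ν| = n`), computed as the scalar product of
characters `(1/n!) ∑_{g ∈ S_n} χ_λ(g) χ_μ(g) χ_ν(g)`; it is `0` if the sizes differ. -/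
noncomputable def kron (l m nu : Partition') : ℕ :=
  if size l = size nu ∧ size m = size nu then
    ((∑ g : Equiv.Perm (Fin (size nu)),
        irrChar (size nu) l g * irrChar (size nu) m g * irrChar (size nu) nu g) /
      (Nat.factorial (size nu) : ℤ)).toNat
  else 0

/-- The standard embedding `S_a × S_b ↪ S_{a+b}`. -/
def sumEmb {a b : ℕ} (g : Equiv.Perm (Fin a)) (h : Equiv.Perm (Fin b)) :
    Equiv.Perm (Fin (a + b)) :=
  (Equiv.permCongr finSumFinEquiv) (Equiv.sumCongr g h)

/-- The Littlewood–Richardson coefficient `c_{λ,μ}^ν`: the multiplicity of `M_ν` in the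
induction of `M_λ ⊠ M_μ` from `S_{|λ|} × S_{|μ|}` to `S_{|λ|+|μ|}`, computed by
Frobenius reciprocity as a scalar product of characters; it is `0` unless
`|ν| = |λ| + |μ|`. -/
noncomputable def lr (l m nu : Partition') : ℕ :=
  if size nu = size l + size m then
    ((∑ g : Equiv.Perm (Fin (size l)), ∑ h : Equiv.Perm (Fin (size m)),
        irrChar (size l) l g * irrChar (size m) m h *
          irrChar (size l + size m) nu (sumEmb g h)) /
      ((Nat.factorial (size l) : ℤ) * (Nat.factorial (size m) : ℤ))).toNat
  else 0

/-- The Aguiar coefficient `a_{λ,μ}^ν`, defined by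
`a_{λ,μ}^ν = Σ_{α,β,δ,η,ρ,τ} c_{α,β}^λ c_{η,ρ}^μ g_{β,η,δ} c_{α,δ}^τ c_{τ,ρ}^ν`. -/
noncomputable def aguiar (l m nu : Partition') : ℕ :=
  ∑ᶠ (α : Partition') (β : Partition') (δ : Partition') (η : Partition')
    (ρ : Partition') (τ : Partition'),
    lr α β l * lr η ρ m * kron β η δ * lr α δ τ * lr τ ρ nu

end Partition'

namespace Partition'

/-- Integer-valued indicator of a proposition. -/
noncomputable def ind (P : Prop) : ℤ := if P then 1 else 0

lemma ind_and (P Q : Prop) : ind (P ∧ Q) = ind P * ind Q := by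
  unfold ind; by_cases hP : P <;> by_cases hQ : Q <;> simp [hP, hQ]

lemma ind_true {P : Prop} (h : P) : ind P = 1 := by simp [ind, h]

lemma ind_false {P : Prop} (h : ¬ P) : ind P = 0 := by simp [ind, h]

lemma sum_ind {X : Type*} (s : Finset X) (P : X → Prop) :
    ∑ x ∈ s, ind (P x) = ((s.filter P).card : ℤ) := by
  simp [ind]

/-- Fibre count. -/
noncomputable def cnt {n : ℕ} {Y : Type} (F : Fin n → Y) (y : Y) : ℕ :=
  Nat.card {x : Fin n // F x = y}

lemma cnt_eq {n : ℕ} {Y : Type} (F : Fin n → Y) (y : Y) :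
    (cnt F y : ℤ) = ∑ x, ind (F x = y) := by
  simp [cnt, ind, Nat.card_eq_fintype_card, Fintype.card_subtype]

/-- The marginal of a table along a map. -/
noncomputable def marg {Y ι : Type} [Fintype Y] (p : Y → ι) (T : Y → ℕ) (i : ι) : ℤ :=
  ∑ y, ind (p y = i) * (T y : ℤ)

lemma cnt_comp {n : ℕ} {Y ι : Type} [Fintype Y] (p : Y → ι) (F : Fin n → Y) (i : ι) :
    (cnt (p ∘ F) i : ℤ) = marg p (cnt F) i := by
  rw [cnt_eq]
  simp only [marg, cnt_eq, Finset.mul_sum]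
  rw [Finset.sum_comm]
  refine Finset.sum_congr rfl fun x _ => ?_
  rw [Finset.sum_eq_single (F x)]
  · simp [ind]
  · intro y _ hy
    rw [ind_false (P := F x = y) (fun h => hy h.symm), mul_zero]
  · simp

/-- Tables with given total. -/
noncomputable def tabs (Y : Type) [Fintype Y] (n : ℕ) : Finset (Y → ℕ) :=
  Finset.piAntidiag Finset.univ n

lemma mem_tabs {Y : Type} [Fintype Y] {n : ℕ} {T : Y → ℕ} :
    T ∈ tabs Y n ↔ ∑ y, T y = n := by
  simp [tabs]

lemma cnt_mem_tabs {n : ℕ} {Y : Type} [Fintype Y] (F : Fin n → Y) : cnt F ∈ tabs Y n := by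
  rw [mem_tabs]
  have : ((∑ y, cnt F y : ℕ) : ℤ) = n := by
    push_cast
    simp only [cnt_eq]
    rw [Finset.sum_comm]
    simp [ind]
  exact_mod_cast this

lemma exists_perm {n : ℕ} {Y : Type} (F F' : Fin n → Y) (h : cnt F = cnt F') :
    ∃ k : Equiv.Perm (Fin n), F ∘ k = F' := by
  have e : ∀ y, Nonempty ({x // F' x = y} ≃ {x // F x = y}) := fun y =>
    Finite.card_eq.1 (congrFun h y).symm
  have q' : ∀ y, {x // F' x = y} ≃ {x // F x = y} := fun y => (e y).some
  refine ⟨(Equiv.sigmaFiberEquiv F').symm.trans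
    ((Equiv.sigmaCongrRight q').trans (Equiv.sigmaFiberEquiv F)), ?_⟩
  funext x
  simp only [Function.comp, Equiv.trans_apply]
  exact (q' (F' x) ⟨x, rfl⟩).2

lemma exists_fun {n : ℕ} {Y : Type} [Fintype Y] (T : Y → ℕ) (h : ∑ y, T y = n) :
    ∃ F : Fin n → Y, cnt F = T := by
  have e : Fin n ≃ Σ y, Fin (T y) := by
    apply Fintype.equivOfCardEq
    simp [h]
  refine ⟨fun x => (e x).1, ?_⟩
  funext y
  unfold cnt
  have e2 : {x : Fin n // (e x).1 = y} ≃ {z : Σ y, Fin (T y) // z.1 = y} :=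
    e.subtypeEquiv (by simp)
  rw [Nat.card_congr e2, Nat.card_congr (Equiv.sigmaSubtype y)]
  simp

lemma burnside_one {n : ℕ} {Y : Type} [Fintype Y] (T : Y → ℕ) (h : ∑ y, T y = n) :
    ∑ F : Fin n → Y, ∑ g : Equiv.Perm (Fin n), ind (F ∘ g = F) * ind (cnt F = T)
      = (n.factorial : ℤ) := by
  obtain ⟨F0, hF0⟩ := exists_fun T h
  have key : ∀ F : Fin n → Y, ∑ g : Equiv.Perm (Fin n), ind (F ∘ g = F) * ind (cnt F = T)
      = ∑ k : Equiv.Perm (Fin n), ind (F0 ∘ k = F) := by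
    intro F
    by_cases hF : cnt F = T
    · obtain ⟨k, hk⟩ := exists_perm F0 F (hF0.trans hF.symm)
      rw [ind_true hF]
      simp only [mul_one]
      refine Fintype.sum_equiv (Equiv.mulLeft k) _ _ fun g => ?_
      congr 1
      simp only [Equiv.coe_mulLeft, Equiv.Perm.coe_mul, ← Function.comp_assoc, hk]
    · rw [ind_false hF]
      simp only [mul_zero, Finset.sum_const_zero]
      symm
      refine Finset.sum_eq_zero fun k _ => ind_false fun hk => hF ?_
      rw [← hk, ← hF0]
      funext y
      unfold cnt
      exact Nat.card_congr (k.subtypeEquiv (by simp))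
  rw [Finset.sum_congr rfl fun F _ => key F, Finset.sum_comm]
  have : ∀ k : Equiv.Perm (Fin n), ∑ F : Fin n → Y, ind (F0 ∘ k = F) = 1 := by
    intro k
    rw [Finset.sum_eq_single (F0 ∘ k)]
    · simp [ind]
    · intro F _ hF
      exact ind_false fun h => hF h.symm
    · simp
  simp [this, Fintype.card_perm]

lemma burnside {n : ℕ} {Y : Type} [Fintype Y] (φ : (Y → ℕ) → ℤ) :
    ∑ g : Equiv.Perm (Fin n), ∑ F : Fin n → Y, ind (F ∘ g = F) * φ (cnt F)
      = (n.factorial : ℤ) * ∑ T ∈ tabs Y n, φ T := by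
  have h1 : ∀ F : Fin n → Y, φ (cnt F) = ∑ T ∈ tabs Y n, ind (cnt F = T) * φ T := by
    intro F
    rw [Finset.sum_eq_single (cnt F)]
    · simp [ind]
    · intro T _ hT
      rw [ind_false (fun h => hT h.symm), zero_mul]
    · intro h
      exact absurd (cnt_mem_tabs F) h
  rw [Finset.sum_comm]
  simp_rw [h1, Finset.mul_sum]
  have : ∀ F : Fin n → Y, ∑ g : Equiv.Perm (Fin n), ∑ T ∈ tabs Y n,
      ind (F ∘ g = F) * (ind (cnt F = T) * φ T) =
      ∑ T ∈ tabs Y n, (∑ g : Equiv.Perm (Fin n), ind (F ∘ g = F) * ind (cnt F = T)) * φ T := by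
    intro F
    rw [Finset.sum_comm]
    simp_rw [Finset.sum_mul, mul_assoc]
  simp_rw [this]
  rw [Finset.sum_comm]
  refine Finset.sum_congr rfl fun T hT => ?_
  rw [← Finset.sum_mul, burnside_one T (mem_tabs.1 hT)]

/-- Fixed point count with arbitrary index type. -/
noncomputable def Yc (n : ℕ) {ι : Type} [Fintype ι] (a : ι → ℤ) (g : Equiv.Perm (Fin n)) : ℤ :=
  ∑ f : Fin n → ι, ind (f ∘ g = f) * ind (∀ i, (cnt f i : ℤ) = a i)

lemma youngCount_eq (n : ℕ) (a : Fin n → ℤ) (g : Equiv.Perm (Fin n)) :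
    youngCount n a g = Yc n a g := by
  unfold youngCount Yc
  simp_rw [← ind_and]
  split_ifs with h
  · rw [Nat.card_eq_fintype_card, Fintype.card_subtype]
    rw [sum_ind]
    congr 2
    ext f
    simp only [Finset.mem_filter, Finset.mem_univ, true_and]
    refine and_congr_right fun _ => forall_congr' fun i => ?_
    have := h i
    unfold cnt
    omega
  · symm
    refine Finset.sum_eq_zero fun f _ => ind_false ?_
    rintro ⟨_, h2⟩
    exact h fun i => by rw [← h2 i]; positivity

lemma kron_count {n : ℕ} {I J K : Type} [Fintype I] [Fintype J] [Fintype K]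
    (a : I → ℤ) (b : J → ℤ) (c : K → ℤ) :
    ∑ g : Equiv.Perm (Fin n), Yc n a g * Yc n b g * Yc n c g
      = (n.factorial : ℤ) * ∑ T ∈ tabs (I × J × K) n,
        (ind (∀ i, marg (fun y : I × J × K => y.1) T i = a i) *
         ind (∀ i, marg (fun y : I × J × K => y.2.1) T i = b i) *
         ind (∀ i, marg (fun y : I × J × K => y.2.2) T i = c i)) := by
  rw [← burnside]
  refine Finset.sum_congr rfl fun g _ => ?_
  unfold Yc
  let E : (Fin n → I × J × K) ≃ (Fin n → I) × (Fin n → J) × (Fin n → K) :=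
    ⟨fun F => (fun x => (F x).1, fun x => (F x).2.1, fun x => (F x).2.2),
     fun f x => (f.1 x, f.2.1 x, f.2.2 x), fun _ => rfl, fun _ => rfl⟩
  symm
  calc _ = ∑ f : (Fin n → I) × (Fin n → J) × (Fin n → K),
        (ind (f.1 ∘ g = f.1) * ind (∀ i, (cnt f.1 i : ℤ) = a i)) *
        (ind (f.2.1 ∘ g = f.2.1) * ind (∀ i, (cnt f.2.1 i : ℤ) = b i)) *
        (ind (f.2.2 ∘ g = f.2.2) * ind (∀ i, (cnt f.2.2 i : ℤ) = c i)) := by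
        refine Fintype.sum_equiv E _ _ fun F => ?_
        have h1 : ind (F ∘ g = F) = ind ((E F).1 ∘ g = (E F).1) *
            ind ((E F).2.1 ∘ g = (E F).2.1) * ind ((E F).2.2 ∘ g = (E F).2.2) := by
          rw [← ind_and, ← ind_and]
          congr 1
          simp only [E, funext_iff, Function.comp, Equiv.coe_fn_mk, Prod.ext_iff,
            forall_and, and_assoc]
        rw [h1]
        have ha : ∀ i, marg (fun y : I × J × K => y.1) (cnt F) i = (cnt (E F).1 i : ℤ) :=
          fun i => (cnt_comp _ F i).symm
        have hb : ∀ i, marg (fun y : I × J × K => y.2.1) (cnt F) i = (cnt (E F).2.1 i : ℤ) :=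
          fun i => (cnt_comp _ F i).symm
        have hc : ∀ i, marg (fun y : I × J × K => y.2.2) (cnt F) i = (cnt (E F).2.2 i : ℤ) :=
          fun i => (cnt_comp _ F i).symm
        simp_rw [ha, hb, hc]
        ring
    _ = _ := by
        simp only [Fintype.sum_prod_type]
        rw [Finset.sum_mul_sum]
        simp only [Finset.sum_mul]
        simp only [Finset.mul_sum]

lemma cnt_append {p q : ℕ} {K : Type} (f : Fin (p + q) → K) (k : K) :
    (cnt f k : ℤ) = cnt (f ∘ Fin.castAdd q) k + cnt (f ∘ Fin.natAdd p) k := by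
  simp only [cnt_eq, Function.comp, Fin.sum_univ_add]

lemma comp_sumEmb {p q : ℕ} {K : Type} (f : Fin (p + q) → K) (g : Equiv.Perm (Fin p))
    (h : Equiv.Perm (Fin q)) :
    f ∘ sumEmb g h = f ↔ (f ∘ Fin.castAdd q) ∘ g = f ∘ Fin.castAdd q ∧
      (f ∘ Fin.natAdd p) ∘ h = f ∘ Fin.natAdd p := by
  simp only [funext_iff, Function.comp, sumEmb]
  constructor
  · intro H
    exact ⟨fun x => by simpa using H (Fin.castAdd q x), fun x => by simpa using H (Fin.natAdd p x)⟩
  · rintro ⟨H1, H2⟩ x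
    refine Fin.addCases (fun x => ?_) (fun x => ?_) x
    · simpa using H1 x
    · simpa using H2 x

lemma Yc_sumEmb {p q : ℕ} {K : Type} [Fintype K] (c : K → ℤ) (g : Equiv.Perm (Fin p))
    (h : Equiv.Perm (Fin q)) :
    Yc (p + q) c (sumEmb g h) = ∑ f : Fin p → K, ∑ f' : Fin q → K,
      ind (f ∘ g = f) * ind (f' ∘ h = f') * ind (∀ k, (cnt f k : ℤ) + cnt f' k = c k) := by
  unfold Yc
  rw [← Fintype.sum_prod_type']
  let E : (Fin (p + q) → K) ≃ (Fin p → K) × (Fin q → K) :=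
    ⟨fun f => (f ∘ Fin.castAdd q, f ∘ Fin.natAdd p), fun f => Fin.append f.1 f.2,
      fun f => by
        funext x
        refine Fin.addCases (fun x => ?_) (fun x => ?_) x <;> simp,
      fun f => by
        refine Prod.ext ?_ ?_ <;> funext x <;> simp⟩
  refine Fintype.sum_equiv E _ _ fun f => ?_
  rw [← ind_and, ← ind_and, ← ind_and]
  simp only [comp_sumEmb, cnt_append, E, Equiv.coe_fn_mk]

lemma prod_fix {n : ℕ} {I K : Type} [Fintype I] [Fintype K] (g : Equiv.Perm (Fin n))
    (φ : (Fin n → I) → (Fin n → K) → ℤ) :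
    ∑ f : Fin n → I, ∑ f' : Fin n → K, ind (f ∘ g = f) * ind (f' ∘ g = f') * φ f f' =
    ∑ F : Fin n → I × K, ind (F ∘ g = F) * φ (Prod.fst ∘ F) (Prod.snd ∘ F) := by
  rw [← Fintype.sum_prod_type']
  let E : (Fin n → I × K) ≃ (Fin n → I) × (Fin n → K) :=
    ⟨fun F => (Prod.fst ∘ F, Prod.snd ∘ F), fun f x => (f.1 x, f.2 x), fun _ => rfl, fun _ => rfl⟩
  symm
  refine Fintype.sum_equiv E _ _ fun F => ?_
  rw [← ind_and]
  congr 2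
  simp only [E, funext_iff, Function.comp, Equiv.coe_fn_mk, Prod.ext_iff,
            forall_and]

lemma lr_count {p q : ℕ} {I J K : Type} [Fintype I] [Fintype J] [Fintype K]
    (a : I → ℤ) (b : J → ℤ) (c : K → ℤ) :
    ∑ g : Equiv.Perm (Fin p), ∑ h : Equiv.Perm (Fin q),
        Yc p a g * Yc q b h * Yc (p + q) c (sumEmb g h)
      = (p.factorial : ℤ) * (q.factorial : ℤ) *
        ∑ T ∈ tabs (I × K) p, ∑ U ∈ tabs (J × K) q,
        (ind (∀ i, marg Prod.fst T i = a i) * ind (∀ i, marg Prod.fst U i = b i) *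
         ind (∀ i, marg Prod.snd T i + marg Prod.snd U i = c i)) := by
  have key : ∀ (g : Equiv.Perm (Fin p)) (h : Equiv.Perm (Fin q)),
      Yc p a g * Yc q b h * Yc (p + q) c (sumEmb g h) =
      ∑ F : Fin p → I × K, ind (F ∘ g = F) * ∑ G : Fin q → J × K, ind (G ∘ h = G) *
        (ind (∀ i, marg Prod.fst (cnt F) i = a i) * ind (∀ i, marg Prod.fst (cnt G) i = b i) *
         ind (∀ i, marg Prod.snd (cnt F) i + marg Prod.snd (cnt G) i = c i)) := by
    intro g h
    rw [Yc_sumEmb]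
    simp_rw [← cnt_comp]
    rw [← prod_fix g (fun f f' => ∑ G : Fin q → J × K, ind (G ∘ h = G) *
        (ind (∀ i, (cnt f i : ℤ) = a i) * ind (∀ i, (cnt (Prod.fst ∘ G) i : ℤ) = b i) *
         ind (∀ i, (cnt f' i : ℤ) + cnt (Prod.snd ∘ G) i = c i)))]
    have h2 : ∀ (f : Fin p → I) (f' : Fin p → K), ∑ G : Fin q → J × K, ind (G ∘ h = G) *
        (ind (∀ i, (cnt f i : ℤ) = a i) * ind (∀ i, (cnt (Prod.fst ∘ G) i : ℤ) = b i) *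
         ind (∀ i, (cnt f' i : ℤ) + cnt (Prod.snd ∘ G) i = c i)) =
         ∑ e : Fin q → J, ∑ e' : Fin q → K, ind (e ∘ h = e) * ind (e' ∘ h = e') *
          (ind (∀ i, (cnt f i : ℤ) = a i) * ind (∀ i, (cnt e i : ℤ) = b i) *
         ind (∀ i, (cnt f' i : ℤ) + cnt e' i = c i)) := by
      intro f f'
      rw [← prod_fix h (fun e e' => (ind (∀ i, (cnt f i : ℤ) = a i) *
        ind (∀ i, (cnt e i : ℤ) = b i) * ind (∀ i, (cnt f' i : ℤ) + cnt e' i = c i)))]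
    simp_rw [h2]
    unfold Yc
    rw [Finset.sum_mul_sum, Finset.sum_mul]
    refine Finset.sum_congr rfl fun f _ => ?_
    simp_rw [Finset.sum_mul, Finset.mul_sum]
    rw [Finset.sum_comm]
    refine Finset.sum_congr rfl fun f' _ => ?_
    refine Finset.sum_congr rfl fun e _ => ?_
    refine Finset.sum_congr rfl fun e' _ => ?_
    ring
  simp_rw [key]
  have h3 : ∀ g : Equiv.Perm (Fin p), ∑ h : Equiv.Perm (Fin q),
      ∑ F : Fin p → I × K, ind (F ∘ g = F) * ∑ G : Fin q → J × K, ind (G ∘ h = G) *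
        (ind (∀ i, marg Prod.fst (cnt F) i = a i) * ind (∀ i, marg Prod.fst (cnt G) i = b i) *
         ind (∀ i, marg Prod.snd (cnt F) i + marg Prod.snd (cnt G) i = c i)) =
      ∑ F : Fin p → I × K, ind (F ∘ g = F) * ((q.factorial : ℤ) * ∑ U ∈ tabs (J × K) q,
        (ind (∀ i, marg Prod.fst (cnt F) i = a i) * ind (∀ i, marg Prod.fst U i = b i) *
         ind (∀ i, marg Prod.snd (cnt F) i + marg Prod.snd U i = c i))) := by
    intro g
    rw [Finset.sum_comm]
    refine Finset.sum_congr rfl fun F _ => ?_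
    rw [← Finset.mul_sum]
    congr 1
    exact burnside (fun U => (ind (∀ i, marg Prod.fst (cnt F) i = a i) *
      ind (∀ i, marg Prod.fst U i = b i) *
         ind (∀ i, marg Prod.snd (cnt F) i + marg Prod.snd U i = c i)))
  simp_rw [h3]
  rw [burnside (fun T => ((q.factorial : ℤ) * ∑ U ∈ tabs (J × K) q,
        (ind (∀ i, marg Prod.fst T i = a i) * ind (∀ i, marg Prod.fst U i = b i) *
         ind (∀ i, marg Prod.snd T i + marg Prod.snd U i = c i)))), ← Finset.mul_sum, mul_assoc]

end Partition'
namespace Partition'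

/-- Jacobi-Trudi exponents. -/
def vals (l : Partition') {r : ℕ} (σ : Equiv.Perm (Fin r)) (i : Fin r) : ℤ :=
  (l.1 i : ℤ) + ((σ i : ℕ) : ℤ) - ((i : ℕ) : ℤ)

/-- Jacobi-Trudi expansion with `r` rows. -/
noncomputable def JT (n : ℕ) (l : Partition') (r : ℕ) (g : Equiv.Perm (Fin n)) : ℤ :=
  ∑ σ : Equiv.Perm (Fin r), (Equiv.Perm.sign σ : ℤ) * Yc n (vals l σ) g

lemma irrChar_eq_JT (n : ℕ) (l : Partition') (g : Equiv.Perm (Fin n)) :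
    irrChar n l g = JT n l n g := by
  unfold irrChar JT
  simp_rw [youngCount_eq]
  rfl

lemma cnt_castSucc {n r : ℕ} (f : Fin n → Fin r) (i : Fin r) :
    cnt (Fin.castSucc ∘ f) i.castSucc = cnt f i := by
  unfold cnt
  simp [Function.comp, Fin.castSucc_inj]

lemma cnt_castSucc_last {n r : ℕ} (f : Fin n → Fin r) :
    cnt (Fin.castSucc ∘ f) (Fin.last r) = 0 := by
  unfold cnt
  simp [Function.comp]

lemma Yc_succ {n r : ℕ} (a : Fin (r + 1) → ℤ) (h : a (Fin.last r) = 0)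
    (g : Equiv.Perm (Fin n)) :
    Yc n (fun i : Fin r => a i.castSucc) g = Yc n a g := by
  unfold Yc
  refine Finset.sum_of_injOn (fun f => Fin.castSucc ∘ f) ?_ ?_ ?_ ?_
  · intro f _ f' _ hff
    exact (Fin.castSucc_injective r).comp_left hff
  · intro f _; simp
  · intro f _ hf
    rw [mul_eq_zero]
    right
    refine ind_false fun H => hf ?_
    have h0 := H (Fin.last r)
    rw [h] at h0
    have h1 : ∀ x, f x ≠ Fin.last r := by
      intro x hx
      have : cnt f (Fin.last r) = 0 := by exact_mod_cast h0
      unfold cnt at this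
      rw [Nat.card_eq_zero] at this
      rcases this with h | h
      · exact h.elim ⟨x, hx⟩
      · exact h.not_finite inferInstance
    refine ⟨fun x => (f x).castPred (h1 x), by simp, ?_⟩
    funext x
    simp
  · intro f _
    congr 1
    · congr 1
      simp [funext_iff, Fin.castSucc_inj]
    · congr 1
      simp [Fin.forall_fin_succ', cnt_castSucc, cnt_castSucc_last, h]

lemma JT_succ (n : ℕ) (l : Partition') (r : ℕ) (g : Equiv.Perm (Fin n)) (h : l.1 r = 0) :
    JT n l r g = JT n l (r + 1) g := by
  unfold JT
  have hc : ∀ (σ : Equiv.Perm (Fin r)) (i : Fin r),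
      σ.viaFintypeEmbedding Fin.castSuccEmb i.castSucc = (σ i).castSucc := fun σ i =>
    Equiv.Perm.viaFintypeEmbedding_apply_image σ Fin.castSuccEmb i
  have hl : ∀ (σ : Equiv.Perm (Fin r)),
      σ.viaFintypeEmbedding Fin.castSuccEmb (Fin.last r) = Fin.last r := fun σ =>
    Equiv.Perm.viaFintypeEmbedding_apply_notMem_range σ Fin.castSuccEmb (by simp)
  refine Finset.sum_of_injOn (fun σ => σ.viaFintypeEmbedding Fin.castSuccEmb) ?_ ?_ ?_ ?_
  · intro σ _ σ' _ hs
    ext i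
    have := congrArg (fun k : Equiv.Perm (Fin (r + 1)) => k i.castSucc) hs
    simp only [hc] at this
    simpa [Fin.ext_iff] using this
  · intro σ _; simp
  · intro σ _ hσ
    by_cases hf : σ (Fin.last r) = Fin.last r
    · exfalso
      apply hσ
      have h1 : ∀ i : Fin r, σ i.castSucc ≠ Fin.last r := by
        intro i hi
        rw [← hf] at hi
        exact (Fin.castSucc_lt_last i).ne (σ.injective hi)
      have inj : Function.Injective fun i : Fin r => (σ i.castSucc).castPred (h1 i) := by
        intro i j hij
        have : σ i.castSucc = σ j.castSucc := by
          simpa [Fin.castPred_inj] using hij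
        exact Fin.castSucc_injective r (σ.injective this)
      refine ⟨Equiv.ofBijective _ (Finite.injective_iff_bijective.1 inj), by simp, ?_⟩
      ext i
      refine Fin.lastCases ?_ (fun i => ?_) i
      · simp only [hl, hf]
      · simp only [hc]; simp
    · rw [mul_eq_zero]
      right
      unfold Yc
      refine Finset.sum_eq_zero fun f _ => ?_
      rw [mul_eq_zero]
      right
      refine ind_false fun H => ?_
      have h2 := H (Fin.last r)
      have h3 : (σ (Fin.last r) : ℕ) < r := by
        have := (σ (Fin.last r)).2
        have h4 : (σ (Fin.last r) : ℕ) ≠ r := fun h => hf (Fin.ext h)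
        omega
      simp only [vals, Fin.val_last, h] at h2
      omega
  · intro σ _
    rw [Equiv.Perm.viaFintypeEmbedding_sign]
    congr 1
    rw [← Yc_succ]
    · congr 1
      funext i
      simp only [vals, hc]
      simp
    · simp only [vals, hl]
      simp [h]

lemma JT_eq_of_le (n : ℕ) (l : Partition') (r s : ℕ) (g : Equiv.Perm (Fin n)) (hrs : r ≤ s)
    (h : ∀ i, r ≤ i → l.1 i = 0) : JT n l r g = JT n l s g := by
  induction s, hrs using Nat.le_induction with
  | base => rfl
  | succ s hs ih => rw [ih, JT_succ n l s g (h s hs)]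

lemma apply_eq_zero (l : Partition') (i : ℕ) (hi : size l ≤ i) : l.1 i = 0 := by
  by_contra h
  have h1 : ∀ j ∈ Finset.range (i + 1), 1 ≤ l.1 j := by
    intro j hj
    have := l.2 (Nat.lt_succ_iff.1 (Finset.mem_range.1 hj))
    omega
  have h2 : Finset.range (i + 1) ⊆ l.1.support := by
    intro j hj
    have := h1 j hj
    rw [Finsupp.mem_support_iff]
    omega
  have h3 : i + 1 ≤ size l := by
    calc i + 1 = ∑ j ∈ Finset.range (i + 1), 1 := by simp
      _ ≤ ∑ j ∈ Finset.range (i + 1), l.1 j := Finset.sum_le_sum h1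
      _ ≤ ∑ j ∈ l.1.support, l.1 j := Finset.sum_le_sum_of_subset h2
  omega

lemma irrChar_eq (n : ℕ) (l : Partition') (r : ℕ) (g : Equiv.Perm (Fin n)) (hn : size l = n)
    (hr : ∀ i, r ≤ i → l.1 i = 0) : irrChar n l g = JT n l r g := by
  rw [irrChar_eq_JT, JT_eq_of_le n l n (max n r) g (le_max_left _ _)
    (fun i hi => apply_eq_zero l i (hn ▸ hi)), ← JT_eq_of_le n l r (max n r) g (le_max_right _ _) hr]

/-- Eventually constant. -/
def EC {X : Type} (f : ℕ → X) : Prop := ∃ c, ∀ᶠ d in Filter.atTop, f d = c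

lemma EC.map {X Z : Type} {f : ℕ → X} (F : X → Z) (h : EC f) : EC fun d => F (f d) := by
  obtain ⟨c, hc⟩ := h
  exact ⟨F c, hc.mono fun d hd => by simp only [hd]⟩

lemma EC.map₂ {X Y Z : Type} {f : ℕ → X} {g : ℕ → Y} (F : X → Y → Z) (h : EC f) (h' : EC g) :
    EC fun d => F (f d) (g d) := by
  obtain ⟨c, hc⟩ := h
  obtain ⟨c', hc'⟩ := h'
  exact ⟨F c c', (hc.and hc').mono fun d hd => by simp only [hd.1, hd.2]⟩

lemma EC.const {X : Type} (c : X) : EC fun _ => c := ⟨c, Filter.Eventually.of_forall fun _ => rfl⟩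

lemma EC.sum {X ι : Type} [AddCommMonoid X] (s : Finset ι) (f : ι → ℕ → X)
    (h : ∀ i ∈ s, EC (f i)) : EC fun d => ∑ i ∈ s, f i d := by
  induction s using Finset.induction_on with
  | empty => simpa using EC.const (0 : X)
  | insert a s ha ih =>
    simp only [Finset.sum_insert ha]
    exact EC.map₂ (· + ·) (h a (by simp)) (ih fun i hi => h i (by simp [hi]))

lemma EC.congr {X : Type} {f g : ℕ → X} (h : EC f) (hfg : ∀ d, g d = f d) : EC g := by
  have : g = f := funext hfg
  rwa [this]

lemma tables_EC {Y C : Type} [Fintype Y] [Fintype C] (S : C → Y → Prop) (v : C → ℤ) (y0 : Y)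
    (h1 : ∀ y, y ≠ y0 → ∃ c, S c y ∧ ¬ S c y0) (h2 : ∃ c, S c y0) :
    EC fun d : ℕ => {T : Y → ℕ | ∀ c, ∑ y, ind (S c y) * (T y : ℤ)
      = v c + ind (S c y0) * (d : ℤ)}.ncard := by
  set A : ℕ → Set (Y → ℕ) := fun d => {T : Y → ℕ | ∀ c, ∑ y, ind (S c y) * (T y : ℤ)
      = v c + ind (S c y0) * (d : ℤ)} with hA
  set V : ℤ := ∑ c, |v c| with hV
  have hV0 : 0 ≤ V := Finset.sum_nonneg fun c _ => abs_nonneg _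
  have hVc : ∀ c, |v c| ≤ V := fun c =>
    Finset.single_le_sum (f := fun c => |v c|) (fun c _ => abs_nonneg _) (Finset.mem_univ c)
  have hind : ∀ P, 0 ≤ ind P ∧ ind P ≤ 1 := by
    intro P; unfold ind; split_ifs <;> simp
  have hb : ∀ d, ∀ T ∈ A d, ∀ y, y ≠ y0 → (T y : ℤ) ≤ V := by
    intro d T hT y hy
    obtain ⟨c, hc, hc0⟩ := h1 y hy
    have h3 := hT c
    rw [ind_false hc0, zero_mul, add_zero] at h3
    have h4 : ind (S c y) * (T y : ℤ) ≤ ∑ y, ind (S c y) * (T y : ℤ) :=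
      Finset.single_le_sum (f := fun y => ind (S c y) * (T y : ℤ))
        (fun y _ => mul_nonneg (hind _).1 (by positivity)) (Finset.mem_univ y)
    rw [ind_true hc, one_mul] at h4
    have := hVc c
    have := le_abs_self (v c)
    linarith
  obtain ⟨c0, hc0⟩ := h2
  set D : ℕ := (V + Fintype.card Y * V).toNat with hD
  have hDeq : (D : ℤ) = V + Fintype.card Y * V := by
    rw [hD, Int.toNat_of_nonneg]; positivity
  have hlow : ∀ d, ∀ T ∈ A d, (d : ℤ) - D ≤ T y0 := by
    intro d T hT
    have h3 := hT c0
    rw [ind_true hc0, one_mul, ← Finset.add_sum_erase _ _ (Finset.mem_univ y0), ind_true hc0,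
      one_mul] at h3
    have h4 : ∑ y ∈ Finset.univ.erase y0, ind (S c0 y) * (T y : ℤ) ≤ Fintype.card Y * V := by
      calc _ ≤ ∑ y ∈ Finset.univ.erase y0, V := by
            refine Finset.sum_le_sum fun y hy => ?_
            have := hb d T hT y (Finset.ne_of_mem_erase hy)
            have h5 := hind (S c0 y)
            have : (0 : ℤ) ≤ T y := by positivity
            nlinarith
        _ ≤ ∑ y : Y, V := Finset.sum_le_sum_of_subset_of_nonneg (Finset.subset_univ _)
            fun _ _ _ => hV0
        _ = _ := by simp
    have := hVc c0
    have := neg_abs_le (v c0)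
    linarith
  have hadd : ∀ (T : Y → ℕ) (k : ℕ) (c : C),
      ∑ y, ind (S c y) * ((T y + (if y = y0 then k else 0) : ℕ) : ℤ) =
      ∑ y, ind (S c y) * (T y : ℤ) + ind (S c y0) * k := by
    intro T k c
    simp only [Nat.cast_add, mul_add, Finset.sum_add_distrib]
    simp
  refine ⟨(A D).ncard, Filter.eventually_atTop.2 ⟨D, fun d hd => ?_⟩⟩
  symm
  refine Set.ncard_congr (fun T _ => fun y => T y + if y = y0 then d - D else 0) ?_ ?_ ?_
  · intro T hT c
    rw [hadd, hT c]
    push_cast [hd]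
    ring
  · intro T T' _ _ h
    funext y
    have := congrFun h y
    simpa using this
  · intro T hT
    have hl := hlow d T hT
    have hT' : (fun y => (T y - (if y = y0 then d - D else 0)) + if y = y0 then d - D else 0)
        = T := by
      funext y
      by_cases hy : y = y0
      · subst hy; simp; omega
      · simp [hy]
    refine ⟨fun y => T y - (if y = y0 then d - D else 0), ?_, hT'⟩
    intro c
    have h3 := hadd (fun y => T y - (if y = y0 then d - D else 0)) (d - D) c
    have h5 : ∀ y, (T y - (if y = y0 then d - D else 0)) + (if y = y0 then d - D else 0) = T y :=
      fun y => congrFun hT' y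
    simp only [h5] at h3
    rw [hT c] at h3
    push_cast [hd] at h3
    linarith

end Partition'
namespace Partition'

lemma marg_fst {I K : Type} [Fintype I] [Fintype K] (T : I × K → ℕ) (i : I) :
    marg Prod.fst T i = ∑ k, (T (i, k) : ℤ) := by
  unfold marg
  rw [Fintype.sum_prod_type, Finset.sum_eq_single i]
  · simp [ind]
  · intro j _ hj
    simp [ind, hj]
  · simp

lemma marg_snd {I K : Type} [Fintype I] [Fintype K] (T : I × K → ℕ) (k : K) :
    marg Prod.snd T k = ∑ i, (T (i, k) : ℤ) := by
  unfold marg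
  rw [Fintype.sum_prod_type_right, Finset.sum_eq_single k]
  · simp [ind]
  · intro j _ hj
    simp [ind, hj]
  · simp

/-- The width of the gap used in the sign-reversing involution. -/
def gap (l : Partition') (i : ℕ) : ℕ := l.1 i - l.1 (i + 1) + 1

/-- The sign-reversing involution. -/
noncomputable def flip' {r : ℕ} {K : Type} (k0 : K) (l : Partition') (i : ℕ)
    (a : Equiv.Perm (Fin r) × (Fin r × K → ℕ)) : Equiv.Perm (Fin r) × (Fin r × K → ℕ) :=
  if h : i + 1 < r then
    (a.1 * Equiv.swap ⟨i, by omega⟩ ⟨i + 1, h⟩, fun y =>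
      if y.2 = k0 ∧ (y.1 : ℕ) = i then a.2 (⟨i + 1, h⟩, k0) + gap l i
      else if y.2 = k0 ∧ (y.1 : ℕ) = i + 1 then a.2 (⟨i, by omega⟩, k0) - gap l i
      else a.2 (Equiv.swap ⟨i, by omega⟩ ⟨i + 1, h⟩ y.1, y.2))
  else a

/-- Bad indices. -/
def bad {r : ℕ} {K : Type} (k0 : K) (l : Partition')
    (a : Equiv.Perm (Fin r) × (Fin r × K → ℕ)) (i : ℕ) : Prop :=
  ∃ h : i + 1 < r, gap l i ≤ a.2 (⟨i, by omega⟩, k0)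

lemma flip_flip {r : ℕ} {K : Type} (k0 : K) (l : Partition') (i : ℕ)
    (a : Equiv.Perm (Fin r) × (Fin r × K → ℕ)) (hb : bad k0 l a i) :
    flip' k0 l i (flip' k0 l i a) = a := by
  obtain ⟨h, hb⟩ := hb
  unfold flip'
  simp only [h, dif_pos]
  refine Prod.ext ?_ ?_
  · simp [mul_assoc]
  · funext ⟨j, k⟩
    simp only
    by_cases hk : k = k0
    · subst hk
      by_cases h1 : (j : ℕ) = i
      · have : j = ⟨i, Nat.lt_of_succ_lt h⟩ := Fin.ext h1
        subst this
        simp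
        omega
      · by_cases h2 : (j : ℕ) = i + 1
        · have : j = ⟨i + 1, h⟩ := Fin.ext h2
          subst this
          simp
        · have e : Equiv.swap (⟨i, by omega⟩ : Fin r) ⟨i + 1, h⟩ j = j :=
            Equiv.swap_apply_of_ne_of_ne (fun e => h1 (by simp [e])) (fun e => h2 (by simp [e]))
          simp [h1, h2, e]
    · simp [hk]

lemma bad_flip {r : ℕ} {K : Type} (k0 : K) (l : Partition') (i : ℕ)
    (a : Equiv.Perm (Fin r) × (Fin r × K → ℕ)) (hb : bad k0 l a i) :
    bad k0 l (flip' k0 l i a) i := by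
  obtain ⟨h, hb⟩ := hb
  refine ⟨h, ?_⟩
  simp [flip', h]

lemma bad_flip_lt {r : ℕ} {K : Type} (k0 : K) (l : Partition') (i j : ℕ) (hj : j < i)
    (a : Equiv.Perm (Fin r) × (Fin r × K → ℕ)) (hb : bad k0 l a i) :
    bad k0 l (flip' k0 l i a) j ↔ bad k0 l a j := by
  obtain ⟨h, hb⟩ := hb
  unfold bad
  refine exists_congr fun hjr => ?_
  have e : Equiv.swap (⟨i, by omega⟩ : Fin r) ⟨i + 1, h⟩ ⟨j, by omega⟩ = ⟨j, by omega⟩ :=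
    Equiv.swap_apply_of_ne_of_ne (fun e => by simp at e; omega) (fun e => by simp at e; omega)
  have h1 : j ≠ i := by omega
  have h2 : j ≠ i + 1 := by omega
  simp [flip', h, e, h1, h2]

lemma flip_val {r : ℕ} {K : Type} (k0 : K) (l : Partition') (i : ℕ)
    (a : Equiv.Perm (Fin r) × (Fin r × K → ℕ)) (h : i + 1 < r)
    (hb : gap l i ≤ a.2 (⟨i, by omega⟩, k0)) (j : Fin r) (k : K) :
    ((flip' k0 l i a).2 (j, k) : ℤ) = a.2 (Equiv.swap ⟨i, by omega⟩ ⟨i + 1, h⟩ j, k) +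
      (if k = k0 then (if (j : ℕ) = i then (gap l i : ℤ) else 0) -
        (if (j : ℕ) = i + 1 then (gap l i : ℤ) else 0) else 0) := by
  simp only [flip', h, dif_pos]
  by_cases hk : k = k0
  · subst hk
    by_cases h1 : (j : ℕ) = i
    · have : j = ⟨i, Nat.lt_of_succ_lt h⟩ := Fin.ext h1
      subst this
      simp
    · by_cases h2 : (j : ℕ) = i + 1
      · have : j = ⟨i + 1, h⟩ := Fin.ext h2
        subst this
        simp
        omega
      · simp [h1, h2]
  · simp [hk]

/-- Tables contributing to the signed sum. -/
def good {r : ℕ} {K : Type} [Fintype K] (l : Partition') (c : K → ℤ)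
    (a : Equiv.Perm (Fin r) × (Fin r × K → ℕ)) : Prop :=
  (∀ i, marg Prod.fst a.2 i = vals l a.1 i) ∧ ∀ k, marg Prod.snd a.2 k = c k

lemma good_flip {r : ℕ} {K : Type} [Fintype K] (k0 : K) (l : Partition') (c : K → ℤ) (i : ℕ)
    (a : Equiv.Perm (Fin r) × (Fin r × K → ℕ)) (hb : bad k0 l a i) (hg : good l c a) :
    good l c (flip' k0 l i a) := by
  obtain ⟨h, hb⟩ := hb
  obtain ⟨hg1, hg2⟩ := hg
  have hgap : (gap l i : ℤ) = l.1 i - l.1 (i + 1) + 1 := by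
    have := l.2 (Nat.le_succ i)
    simp only [Nat.succ_eq_add_one] at this
    unfold gap
    push_cast [this]
    ring
  constructor
  · intro j
    rw [marg_fst]
    simp only [flip_val k0 l i a h hb, Finset.sum_add_distrib]
    rw [← marg_fst, hg1]
    simp only [Finset.sum_ite_eq', Finset.mem_univ, if_true]
    by_cases h1 : (j : ℕ) = i
    · have : j = ⟨i, Nat.lt_of_succ_lt h⟩ := Fin.ext h1
      subst this
      simp [vals, flip', h]
      omega
    · by_cases h2 : (j : ℕ) = i + 1
      · have : j = ⟨i + 1, h⟩ := Fin.ext h2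
        subst this
        simp [vals, flip', h]
        omega
      · have e : Equiv.swap (⟨i, by omega⟩ : Fin r) ⟨i + 1, h⟩ j = j :=
            Equiv.swap_apply_of_ne_of_ne (fun e => h1 (by simp [e])) (fun e => h2 (by simp [e]))
        simp [vals, flip', h, h1, h2, e]
  · intro k
    rw [marg_snd]
    simp only [flip_val k0 l i a h hb, Finset.sum_add_distrib]
    rw [Equiv.sum_comp (Equiv.swap (⟨i, by omega⟩ : Fin r) ⟨i + 1, h⟩)
      (fun j => (a.2 (j, k) : ℤ)), ← marg_snd, hg2]
    by_cases hk : k = k0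
    · simp only [hk, if_true, Finset.sum_sub_distrib]
      rw [Finset.sum_eq_single (⟨i, by omega⟩ : Fin r), Finset.sum_eq_single (⟨i + 1, h⟩ : Fin r)]
      · simp
      · intro j _ hj
        rw [if_neg]
        exact fun e => hj (Fin.ext e)
      · simp
      · intro j _ hj
        rw [if_neg]
        exact fun e => hj (Fin.ext e)
      · simp
    · simp [hk]

lemma exists_bad {r : ℕ} {K : Type} [Fintype K] (k0 : K) (l : Partition') (c : K → ℤ)
    (hc : (l.1 0 : ℤ) < c k0)
    (a : Equiv.Perm (Fin r) × (Fin r × K → ℕ)) (hg : good l c a) :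
    ∃ i, bad k0 l a i := by
  by_contra! hno
  have h1 : ∀ i : Fin r, (a.2 (i, k0) : ℤ) ≤ (if (i : ℕ) + 1 < r then
      (l.1 i : ℤ) - l.1 (i + 1) else l.1 i) := by
    intro i
    split_ifs with hi
    · have := hno i
      simp only [bad, not_exists, not_le] at this
      have := this hi
      have hm := l.2 (Nat.le_succ i)
      simp only [Nat.succ_eq_add_one] at hm
      unfold gap at this
      simp only [Fin.eta] at this
      omega
    · have h2 := hg.1 i
      rw [marg_fst] at h2
      have h3 : (a.2 (i, k0) : ℤ) ≤ ∑ k, (a.2 (i, k) : ℤ) :=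
        Finset.single_le_sum (f := fun k => (a.2 (i, k) : ℤ)) (fun _ _ => by positivity)
          (Finset.mem_univ k0)
      rw [h2] at h3
      unfold vals at h3
      have := (a.1 i).2
      omega
  have h2 := hg.2 k0
  rw [marg_snd] at h2
  have h3 : c k0 ≤ ∑ i : Fin r, (if (i : ℕ) + 1 < r then
      (l.1 i : ℤ) - l.1 (i + 1) else l.1 i) := by
    rw [← h2]
    exact Finset.sum_le_sum fun i _ => h1 i
  rw [Fin.sum_univ_eq_sum_range (fun i => if i + 1 < r then
      (l.1 i : ℤ) - l.1 (i + 1) else l.1 i) r] at h3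
  have h4 : ∑ i ∈ Finset.range r, (if i + 1 < r then
      (l.1 i : ℤ) - l.1 (i + 1) else l.1 i) ≤ l.1 0 := by
    rcases r with _ | r
    · simp
    · rw [Finset.sum_range_succ]
      have : ∀ i ∈ Finset.range r, (if i + 1 < r + 1 then
        (l.1 i : ℤ) - l.1 (i + 1) else l.1 i) = (l.1 i : ℤ) - l.1 (i + 1) := by
        intro i hi
        rw [if_pos (by simpa using hi)]
      rw [Finset.sum_congr rfl this, Finset.sum_range_sub' (fun i => (l.1 i : ℤ))]
      simp
  omega

lemma signed_vanish {r q : ℕ} {K : Type} [Fintype K] (k0 : K) (l : Partition') (c : K → ℤ)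
    (hc : (l.1 0 : ℤ) < c k0) :
    ∑ σ : Equiv.Perm (Fin r), (Equiv.Perm.sign σ : ℤ) * ∑ U ∈ tabs (Fin r × K) q,
      (ind (∀ i, marg Prod.fst U i = vals l σ i) * ind (∀ k, marg Prod.snd U k = c k)) = 0 := by
  simp_rw [Finset.mul_sum, ← ind_and]
  rw [← Finset.sum_product']
  have : ∀ a ∈ (Finset.univ : Finset (Equiv.Perm (Fin r))) ×ˢ tabs (Fin r × K) q,
      (Equiv.Perm.sign a.1 : ℤ) * ind ((∀ i, marg Prod.fst a.2 i = vals l a.1 i) ∧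
        ∀ k, marg Prod.snd a.2 k = c k) = if good l c a then (Equiv.Perm.sign a.1 : ℤ) else 0 := by
    intro a _
    unfold ind good
    split_ifs <;> simp
  rw [Finset.sum_congr rfl this, ← Finset.sum_filter]
  have hbad : ∀ a ∈ Finset.filter (good l c)
      ((Finset.univ : Finset (Equiv.Perm (Fin r))) ×ˢ tabs (Fin r × K) q),
      bad k0 l a (sInf {i | bad k0 l a i}) := by
    intro a ha
    exact Nat.sInf_mem (exists_bad k0 l c hc a (Finset.mem_filter.1 ha).2)
  have hsInf : ∀ a ∈ Finset.filter (good l c)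
      ((Finset.univ : Finset (Equiv.Perm (Fin r))) ×ˢ tabs (Fin r × K) q),
      sInf {i | bad k0 l (flip' k0 l (sInf {i | bad k0 l a i}) a) i} = sInf {i | bad k0 l a i} := by
    intro a ha
    have hb := hbad a ha
    apply le_antisymm
    · exact Nat.sInf_le (bad_flip k0 l _ a hb)
    · by_contra! hlt
      have h1 : bad k0 l (flip' k0 l (sInf {i | bad k0 l a i}) a)
          (sInf {i | bad k0 l (flip' k0 l (sInf {i | bad k0 l a i}) a) i}) :=
        Nat.sInf_mem (s := {i | bad k0 l (flip' k0 l (sInf {i | bad k0 l a i}) a) i})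
          ⟨_, bad_flip k0 l _ a hb⟩
      rw [bad_flip_lt k0 l _ _ hlt a hb] at h1
      exact absurd (Nat.sInf_le (s := {i | bad k0 l a i}) h1) (not_le.2 hlt)
  have hsign : ∀ a ∈ Finset.filter (good l c)
      ((Finset.univ : Finset (Equiv.Perm (Fin r))) ×ˢ tabs (Fin r × K) q),
      (Equiv.Perm.sign (flip' k0 l (sInf {i | bad k0 l a i}) a).1 : ℤ) =
        - (Equiv.Perm.sign a.1 : ℤ) := by
    intro a ha
    obtain ⟨h, hb⟩ := hbad a ha
    simp [flip', h]
  refine Finset.sum_involution (fun a _ => flip' k0 l (sInf {i | bad k0 l a i}) a) ?_ ?_ ?_ ?_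
  · intro a ha
    rw [hsign a ha]; ring
  · intro a ha _ he
    have := hsign a ha
    rw [he] at this
    have h2 : (Equiv.Perm.sign a.1 : ℤ) ≠ 0 := by simp
    omega
  · intro a ha
    have hb := hbad a ha
    have ha' := Finset.mem_filter.1 ha
    have hg := good_flip k0 l c _ a hb ha'.2
    refine Finset.mem_filter.2 ⟨Finset.mem_product.2 ⟨Finset.mem_univ _, ?_⟩, hg⟩
    have ht := mem_tabs.1 (Finset.mem_product.1 ha'.1).2
    rw [mem_tabs, ← ht]
    have hs : ∀ b : Equiv.Perm (Fin r) × (Fin r × K → ℕ), good l c b →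
        ((∑ y, b.2 y : ℕ) : ℤ) = ∑ k, c k := by
      intro b hb
      push_cast
      rw [Fintype.sum_prod_type_right]
      exact Finset.sum_congr rfl fun k _ => by rw [← hb.2 k, marg_snd]
    have := (hs _ hg).trans (hs _ ha'.2).symm
    exact_mod_cast this
  · intro a ha
    simp only [hsInf a ha]
    exact flip_flip k0 l _ a (hbad a ha)

end Partition'
namespace Partition'

lemma tabs_EC {Y C : Type} [Fintype Y] [Fintype C] (S : C → Y → Prop) (v : C → ℤ) (y0 : Y)
    (q : ℕ) (h1 : ∀ y, y ≠ y0 → ∃ c, S c y ∧ ¬ S c y0) :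
    EC fun d : ℕ => ∑ T ∈ tabs Y (q + d), ind (∀ c, ∑ y, ind (S c y) * (T y : ℤ)
      = v c + ind (S c y0) * (d : ℤ)) := by
  have h := tables_EC (Y := Y) (C := Option C) (fun c y => c.elim True (fun c => S c y))
    (fun c => c.elim (q : ℤ) v) y0 (fun y hy => by
      obtain ⟨c, hc⟩ := h1 y hy
      exact ⟨some c, hc⟩) ⟨none, trivial⟩
  refine (h.map (fun n : ℕ => (n : ℤ))).congr fun d => ?_
  rw [sum_ind, ← Set.ncard_coe_finset]
  congr 2
  ext T
  simp only [Finset.coe_filter, mem_tabs, Set.mem_ofPred_eq, Option.forall, Option.elim]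
  refine and_congr_left fun _ => ?_
  simp only [ind_true trivial, one_mul]
  norm_cast

lemma two_EC {J K : Type} [Fintype J] [Fintype K] (j0 : J) (k0 : K) (b : J → ℤ) (c : K → ℤ)
    (q : ℕ) : EC fun d : ℕ => ∑ U ∈ tabs (J × K) (q + d),
      (ind (∀ i, marg Prod.fst U i = b i + ind (j0 = i) * (d : ℤ)) *
        ind (∀ i, marg Prod.snd U i = c i + ind (k0 = i) * (d : ℤ))) := by
  refine (tabs_EC (Y := J × K) (C := J ⊕ K)
    (fun c y => c.elim (fun i => y.1 = i) (fun i => y.2 = i))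
    (fun i => i.elim b c) (j0, k0) q ?_).congr fun d => ?_
  · rintro ⟨j, k⟩ h
    by_cases hj : j = j0
    · exact ⟨Sum.inr k, rfl, fun h' => h (by simp at h'; simp [hj, h'])⟩
    · exact ⟨Sum.inl j, rfl, fun h' => hj h'.symm⟩
  · refine Finset.sum_congr rfl fun U _ => ?_
    rw [← ind_and]
    simp only [Sum.forall, Sum.elim_inl, Sum.elim_inr, marg]

lemma three_EC {I J K : Type} [Fintype I] [Fintype J] [Fintype K] (i0 : I) (j0 : J) (k0 : K)
    (a : I → ℤ) (b : J → ℤ) (c : K → ℤ) (q : ℕ) :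
    EC fun d : ℕ => ∑ U ∈ tabs (I × J × K) (q + d),
      (ind (∀ i, marg (fun y : I × J × K => y.1) U i = a i + ind (i0 = i) * (d : ℤ)) *
        ind (∀ i, marg (fun y : I × J × K => y.2.1) U i = b i + ind (j0 = i) * (d : ℤ)) *
        ind (∀ i, marg (fun y : I × J × K => y.2.2) U i = c i + ind (k0 = i) * (d : ℤ))) := by
  refine (tabs_EC (Y := I × J × K) (C := I ⊕ J ⊕ K)
    (fun c y => c.elim (fun i => y.1 = i) (fun c => c.elim (fun i => y.2.1 = i)
      (fun i => y.2.2 = i)))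
    (fun i => i.elim a (fun i => i.elim b c)) (i0, j0, k0) q ?_).congr fun d => ?_
  · rintro ⟨i, j, k⟩ h
    by_cases hi : i = i0
    · by_cases hj : j = j0
      · exact ⟨Sum.inr (Sum.inr k), rfl, fun h' => h (by simp at h'; simp [hi, hj, h'])⟩
      · exact ⟨Sum.inr (Sum.inl j), rfl, fun h' => hj h'.symm⟩
    · exact ⟨Sum.inl i, rfl, fun h' => hi h'.symm⟩
  · refine Finset.sum_congr rfl fun U _ => ?_
    rw [← ind_and, ← ind_and, and_assoc]
    simp only [Sum.forall, Sum.elim_inl, Sum.elim_inr, marg]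

/-- Table formula for the scalar product giving the Littlewood-Richardson coefficient. -/
noncomputable def lrZ (r p q : ℕ) (l m nu : Partition') : ℤ :=
  ∑ σ : Equiv.Perm (Fin r), ∑ π : Equiv.Perm (Fin r), ∑ ω : Equiv.Perm (Fin r),
    (Equiv.Perm.sign σ : ℤ) * (Equiv.Perm.sign π : ℤ) * (Equiv.Perm.sign ω : ℤ) *
    ∑ T ∈ tabs (Fin r × Fin r) p, ∑ U ∈ tabs (Fin r × Fin r) q,
        (ind (∀ i, marg Prod.fst T i = vals l σ i) * ind (∀ i, marg Prod.fst U i = vals m π i) *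
         ind (∀ i, marg Prod.snd T i + marg Prod.snd U i = vals nu ω i))

/-- Table formula for the scalar product giving the Kronecker coefficient. -/
noncomputable def kronZ (r n : ℕ) (l m nu : Partition') : ℤ :=
  ∑ σ : Equiv.Perm (Fin r), ∑ π : Equiv.Perm (Fin r), ∑ ω : Equiv.Perm (Fin r),
    (Equiv.Perm.sign σ : ℤ) * (Equiv.Perm.sign π : ℤ) * (Equiv.Perm.sign ω : ℤ) *
    ∑ T ∈ tabs (Fin r × Fin r × Fin r) n,
        (ind (∀ i, marg (fun y : Fin r × Fin r × Fin r => y.1) T i = vals l σ i) *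
         ind (∀ i, marg (fun y : Fin r × Fin r × Fin r => y.2.1) T i = vals m π i) *
         ind (∀ i, marg (fun y : Fin r × Fin r × Fin r => y.2.2) T i = vals nu ω i))

lemma triple_sum {G A : Type} [Fintype G] [Fintype A] (s : A → ℤ) (x y z : A → G → ℤ) :
    ∑ g, (∑ σ, s σ * x σ g) * (∑ σ, s σ * y σ g) * (∑ σ, s σ * z σ g) =
    ∑ σ, ∑ π, ∑ ω, s σ * s π * s ω * ∑ g, x σ g * y π g * z ω g := by
  have : ∀ g, (∑ σ, s σ * x σ g) * (∑ σ, s σ * y σ g) * (∑ σ, s σ * z σ g) =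
      ∑ σ, ∑ π, ∑ ω, s σ * s π * s ω * (x σ g * y π g * z ω g) := by
    intro g
    rw [Finset.sum_mul_sum]
    simp only [Finset.sum_mul]
    simp only [Finset.mul_sum]
    refine Finset.sum_congr rfl fun σ _ => ?_
    refine Finset.sum_congr rfl fun π _ => ?_
    refine Finset.sum_congr rfl fun ω _ => ?_
    ring
  simp_rw [this, Finset.mul_sum]
  rw [Finset.sum_comm]
  refine Finset.sum_congr rfl fun σ _ => ?_
  rw [Finset.sum_comm]
  refine Finset.sum_congr rfl fun π _ => ?_
  rw [Finset.sum_comm]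

lemma lr_eq (r : ℕ) (l m nu : Partition') (hl : ∀ i, r ≤ i → l.1 i = 0)
    (hm : ∀ i, r ≤ i → m.1 i = 0) (hn : ∀ i, r ≤ i → nu.1 i = 0) :
    lr l m nu = if size nu = size l + size m then (lrZ r (size l) (size m) l m nu).toNat
      else 0 := by
  unfold lr
  split_ifs with h
  · congr 1
    simp_rw [irrChar_eq (size l) l r _ rfl hl, irrChar_eq (size m) m r _ rfl hm,
      irrChar_eq (size l + size m) nu r _ h hn]
    unfold JT
    rw [← Fintype.sum_prod_type' (f := fun g h => (∑ σ : Equiv.Perm (Fin r),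
      (Equiv.Perm.sign σ : ℤ) * Yc (size l) (vals l σ) g) * (∑ σ : Equiv.Perm (Fin r),
      (Equiv.Perm.sign σ : ℤ) * Yc (size m) (vals m σ) h) * (∑ σ : Equiv.Perm (Fin r),
      (Equiv.Perm.sign σ : ℤ) * Yc (size l + size m) (vals nu σ) (sumEmb g h)))]
    rw [triple_sum (G := Equiv.Perm (Fin (size l)) × Equiv.Perm (Fin (size m)))
      (A := Equiv.Perm (Fin r)) (fun σ => (Equiv.Perm.sign σ : ℤ))
      (fun σ g => Yc (size l) (vals l σ) g.1) (fun σ g => Yc (size m) (vals m σ) g.2)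
      (fun σ g => Yc (size l + size m) (vals nu σ) (sumEmb g.1 g.2))]
    simp_rw [Fintype.sum_prod_type, lr_count]
    apply Int.ediv_eq_of_eq_mul_right
    · positivity
    · unfold lrZ
      simp_rw [Finset.mul_sum]
      refine Finset.sum_congr rfl fun σ _ => ?_
      refine Finset.sum_congr rfl fun π _ => ?_
      refine Finset.sum_congr rfl fun ω _ => ?_
      refine Finset.sum_congr rfl fun T _ => ?_
      refine Finset.sum_congr rfl fun U _ => ?_
      ring
  · rfl

lemma kron_eq (r : ℕ) (l m nu : Partition') (hl : ∀ i, r ≤ i → l.1 i = 0)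
    (hm : ∀ i, r ≤ i → m.1 i = 0) (hn : ∀ i, r ≤ i → nu.1 i = 0) :
    kron l m nu = if size l = size nu ∧ size m = size nu then
      (kronZ r (size nu) l m nu).toNat else 0 := by
  unfold kron
  split_ifs with h
  · congr 1
    simp_rw [irrChar_eq (size nu) l r _ h.1 hl, irrChar_eq (size nu) m r _ h.2 hm,
      irrChar_eq (size nu) nu r _ rfl hn]
    unfold JT
    rw [triple_sum]
    simp_rw [kron_count]
    apply Int.ediv_eq_of_eq_mul_right
    · positivity
    · unfold kronZ
      simp_rw [Finset.mul_sum]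
      refine Finset.sum_congr rfl fun σ _ => ?_
      refine Finset.sum_congr rfl fun π _ => ?_
      refine Finset.sum_congr rfl fun ω _ => ?_
      refine Finset.sum_congr rfl fun T _ => ?_
      ring
  · rfl

lemma lrZ_comm (r p q : ℕ) (l m nu : Partition') : lrZ r p q l m nu = lrZ r q p m l nu := by
  unfold lrZ
  rw [Finset.sum_comm]
  refine Finset.sum_congr rfl fun σ _ => ?_
  refine Finset.sum_congr rfl fun π _ => ?_
  refine Finset.sum_congr rfl fun ω _ => ?_
  rw [Finset.sum_comm]
  congr 1
  · ring
  · refine Finset.sum_congr rfl fun T _ => ?_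
    refine Finset.sum_congr rfl fun U _ => ?_
    simp_rw [add_comm (marg Prod.snd U _)]
    ring

lemma lr_comm (l m nu : Partition') : lr l m nu = lr m l nu := by
  have h : ∀ x : Partition', size x ≤ size l + size m + size nu →
      ∀ i, size l + size m + size nu ≤ i → x.1 i = 0 :=
    fun x hx i hi => apply_eq_zero x i (hx.trans hi)
  have hl := h l (by omega)
  have hm := h m (by omega)
  have hn := h nu (by omega)
  rw [lr_eq _ l m nu hl hm hn, lr_eq _ m l nu hm hl hn, lrZ_comm, add_comm (size m)]

lemma lrZ_vanish (R p q : ℕ) (l m nu : Partition') (h : m.1 0 + p < nu.1 0) :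
    lrZ (R + 1) p q l m nu = 0 := by
  unfold lrZ
  refine Finset.sum_eq_zero fun σ _ => ?_
  rw [Finset.sum_comm]
  refine Finset.sum_eq_zero fun ω _ => ?_
  simp_rw [Finset.mul_sum]
  rw [Finset.sum_comm]
  refine Finset.sum_eq_zero fun T hT => ?_
  have hT := mem_tabs.1 hT
  have hc : (m.1 0 : ℤ) < vals nu ω 0 - marg Prod.snd T 0 := by
    have h1 : marg Prod.snd T 0 ≤ (p : ℤ) := by
      rw [← hT, marg]
      push_cast
      refine Finset.sum_le_sum fun y _ => ?_
      unfold ind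
      split_ifs <;> simp
    simp only [vals, Fin.val_zero]
    have : (m.1 0 : ℤ) + p < nu.1 0 := by exact_mod_cast h
    have h3 : (0 : ℤ) ≤ ((ω 0 : ℕ) : ℤ) := by positivity
    push_cast
    linarith
  have key := signed_vanish (r := R + 1) (q := q) (0 : Fin (R + 1)) m
    (fun k => vals nu ω k - marg Prod.snd T k) hc
  calc _ = ((Equiv.Perm.sign σ : ℤ) * (Equiv.Perm.sign ω : ℤ) *
        ind (∀ i, marg Prod.fst T i = vals l σ i)) *
        ∑ π : Equiv.Perm (Fin (R + 1)), (Equiv.Perm.sign π : ℤ) *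
        ∑ U ∈ tabs (Fin (R + 1) × Fin (R + 1)) q,
        (ind (∀ i, marg Prod.fst U i = vals m π i) *
          ind (∀ k, marg Prod.snd U k = vals nu ω k - marg Prod.snd T k)) := by
        simp_rw [Finset.mul_sum]
        refine Finset.sum_congr rfl fun π _ => ?_
        refine Finset.sum_congr rfl fun U _ => ?_
        simp_rw [eq_sub_iff_add_eq, add_comm (marg Prod.snd U _)]
        ring
    _ = 0 := by rw [key, mul_zero]

lemma lr_bound (l m nu : Partition') (h : lr l m nu ≠ 0) : nu.1 0 ≤ m.1 0 + size l := by
  by_contra! hlt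
  have hz : ∀ x : Partition', size x ≤ size l + size m + size nu →
      ∀ i, size l + size m + size nu + 1 ≤ i → x.1 i = 0 :=
    fun x hx i hi => apply_eq_zero x i (by omega)
  apply h
  rw [lr_eq _ l m nu (hz l (by omega)) (hz m (by omega)) (hz nu (by omega)),
    lrZ_vanish _ _ _ _ _ _ hlt]
  simp

lemma lr_size {l m nu : Partition'} (h : lr l m nu ≠ 0) : size nu = size l + size m := by
  by_contra h'
  exact h (by simp [lr, h'])

lemma kron_size {l m nu : Partition'} (h : kron l m nu ≠ 0) :
    size l = size nu ∧ size m = size nu := by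
  by_contra h'
  exact h (by rw [kron, if_neg h'])

lemma add_row_apply (l : Partition') (d i : ℕ) :
    (l + row d).1 i = l.1 i + if i = 0 then d else 0 := by
  change (l.1 + Finsupp.single 0 d : ℕ →₀ ℕ) i = _
  simp [Finsupp.single_apply, eq_comm]

lemma size_add_row (l : Partition') (d : ℕ) : size (l + row d) = size l + d := by
  change (l.1 + Finsupp.single 0 d : ℕ →₀ ℕ).sum (fun _ v => v) = _
  rw [Finsupp.sum_add_index' (by simp) (by simp), Finsupp.sum_single_index rfl]
  rfl

lemma vals_row {R : ℕ} (l : Partition') (d : ℕ) (σ : Equiv.Perm (Fin (R + 1)))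
    (i : Fin (R + 1)) :
    vals (l + row d) σ i = vals l σ i + ind (0 = i) * (d : ℤ) := by
  unfold vals
  rw [add_row_apply]
  by_cases h : i = 0
  · subst h
    simp [ind]
    ring
  · have h0 : (i : ℕ) ≠ 0 := fun h' => h (Fin.ext h')
    rw [ind_false (fun h' => h h'.symm), if_neg h0]
    simp

lemma lr_EC (l m nu : Partition') : EC fun d => lr l (m + row d) (nu + row d) := by
  set R := size l + size m + size nu with hR
  have hz : ∀ x : Partition', size x ≤ R → ∀ i, R + 1 ≤ i → x.1 i = 0 :=
    fun x hx i hi => apply_eq_zero x i (by omega)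
  have hz' : ∀ x : Partition', size x ≤ R → ∀ d i, R + 1 ≤ i → (x + row d).1 i = 0 := by
    intro x hx d i hi
    rw [add_row_apply, hz x hx i hi, if_neg (by omega)]
  have e : ∀ d, lr l (m + row d) (nu + row d) = if size nu = size l + size m then
      (lrZ (R + 1) (size l) (size m + d) l (m + row d) (nu + row d)).toNat else 0 := by
    intro d
    rw [lr_eq (R + 1) l _ _ (hz l (by omega)) (hz' m (by omega) d) (hz' nu (by omega) d)]
    simp only [size_add_row]
    congr 1
    simp only [eq_iff_iff]
    omega
  refine EC.congr ?_ e
  by_cases hs : size nu = size l + size m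
  · simp only [hs, if_true]
    refine EC.map Int.toNat ?_
    unfold lrZ
    refine EC.sum _ _ fun σ _ => EC.sum _ _ fun π _ => EC.sum _ _ fun ω _ => ?_
    refine EC.map _ ?_
    refine EC.sum _ _ fun T _ => ?_
    have := (two_EC (0 : Fin (R + 1)) (0 : Fin (R + 1)) (vals m π)
      (fun i => vals nu ω i - marg Prod.snd T i) (size m)).map
      (fun z => ind (∀ i, marg Prod.fst T i = vals l σ i) * z)
    refine this.congr fun d => ?_
    rw [Finset.mul_sum]
    refine Finset.sum_congr rfl fun U _ => ?_
    rw [mul_assoc]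
    congr 2
    · simp_rw [vals_row]
    · congr 1
      simp_rw [vals_row]
      refine propext (forall_congr' fun i => ?_)
      constructor <;> intro h <;> linarith
  · simp only [hs, if_false]
    exact EC.const 0

lemma kron_EC (l m nu : Partition') :
    EC fun d => kron (l + row d) (m + row d) (nu + row d) := by
  set R := size l + size m + size nu with hR
  have hz : ∀ x : Partition', size x ≤ R → ∀ i, R + 1 ≤ i → x.1 i = 0 :=
    fun x hx i hi => apply_eq_zero x i (by omega)
  have hz' : ∀ x : Partition', size x ≤ R → ∀ d i, R + 1 ≤ i → (x + row d).1 i = 0 := by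
    intro x hx d i hi
    rw [add_row_apply, hz x hx i hi, if_neg (by omega)]
  have e : ∀ d, kron (l + row d) (m + row d) (nu + row d) =
      if size l = size nu ∧ size m = size nu then
      (kronZ (R + 1) (size nu + d) (l + row d) (m + row d) (nu + row d)).toNat else 0 := by
    intro d
    rw [kron_eq (R + 1) _ _ _ (hz' l (by omega) d) (hz' m (by omega) d) (hz' nu (by omega) d)]
    simp only [size_add_row]
    congr 1
    simp only [eq_iff_iff]
    omega
  refine EC.congr ?_ e
  by_cases hs : size l = size nu ∧ size m = size nu
  · simp only [hs, and_self, if_true]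
    refine EC.map Int.toNat ?_
    unfold kronZ
    refine EC.sum _ _ fun σ _ => EC.sum _ _ fun π _ => EC.sum _ _ fun ω _ => ?_
    refine EC.map _ ?_
    simp_rw [vals_row]
    exact three_EC _ _ _ _ _ _ _
  · simp only [hs, if_false]
    exact EC.const 0

lemma apply_le_size (l : Partition') (i : ℕ) : l.1 i ≤ size l := by
  by_cases h : i ∈ l.1.support
  · exact Finset.single_le_sum (f := fun i => l.1 i) (fun _ _ => Nat.zero_le _) h
  · rw [Finsupp.notMem_support_iff.1 h]
    exact Nat.zero_le _

lemma ext' {l m : Partition'} (h : ∀ i, l.1 i = m.1 i) : l = m :=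
  Subtype.ext (Finsupp.ext h)

lemma finite_size_le (M : ℕ) : {l : Partition' | size l ≤ M}.Finite := by
  rw [← Set.finite_coe_iff]
  refine Finite.of_injective (β := Fin M → Fin (M + 1)) (fun l i => ⟨l.1.1 i, ?_⟩) ?_
  · have h1 := apply_le_size l.1 i
    have h2 : size l.1 ≤ M := l.2
    omega
  · intro l l' h
    apply Subtype.ext
    apply ext'
    intro i
    by_cases hi : i < M
    · simpa using congrFun h ⟨i, hi⟩
    · have h2 : size l.1 ≤ M := l.2
      have h3 : size l'.1 ≤ M := l'.2
      rw [apply_eq_zero _ _ (by omega), apply_eq_zero _ _ (by omega)]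

lemma add_row_inj {l m : Partition'} {d : ℕ} (h : l + row d = m + row d) : l = m := by
  apply ext'
  intro i
  have := congrArg (fun x : Partition' => x.1 i) h
  simp only [add_row_apply] at this
  omega

lemma add_row_add (l : Partition') (d e : ℕ) : l + row (d + e) = l + row d + row e := by
  apply ext'
  intro i
  simp only [add_row_apply]
  split_ifs <;> omega

lemma add_row_zero (l : Partition') : l + row 0 = l := by
  apply ext'
  intro i
  simp [add_row_apply]

lemma exists_sub_row (l : Partition') (e : ℕ) (h : l.1 1 + e ≤ l.1 0) :
    ∃ l', l = l' + row e := by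
  refine ⟨⟨l.1 - Finsupp.single 0 e, ?_⟩, ?_⟩
  · intro i j hij
    simp only [Finsupp.coe_tsub, Pi.sub_apply, Finsupp.single_apply]
    have h1 := l.2 hij
    by_cases hj : j = 0
    · have : i = 0 := by omega
      subst this; subst hj; exact le_rfl
    · have h2 : l.1 j ≤ l.1 1 := l.2 (by omega)
      by_cases hi : i = 0
      · subst hi
        rw [if_pos rfl, if_neg (Ne.symm hj)]
        omega
      · rw [if_neg (Ne.symm hi), if_neg (Ne.symm hj)]
        omega
  · apply ext'
    intro i
    refine Eq.trans ?_ (add_row_apply _ _ _).symm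
    change l.1 i = (l.1 - Finsupp.single 0 e : ℕ →₀ ℕ) i + _
    simp only [Finsupp.coe_tsub, Pi.sub_apply, Finsupp.single_apply]
    by_cases hi : i = 0
    · subst hi
      simp
      omega
    · simp [hi, Ne.symm hi]

lemma two_le_size (l : Partition') : l.1 0 + l.1 1 ≤ size l := by
  by_cases h : l.1 1 = 0
  · rw [h]; exact apply_le_size l 0
  · have h0 : l.1 1 ≤ l.1 0 := l.2 (by omega)
    have : ({0, 1} : Finset ℕ) ⊆ l.1.support := by
      intro i hi
      simp only [Finset.mem_insert, Finset.mem_singleton] at hi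
      rw [Finsupp.mem_support_iff]
      rcases hi with rfl | rfl <;> omega
    calc l.1 0 + l.1 1 = ∑ i ∈ ({0, 1} : Finset ℕ), l.1 i := by simp
      _ ≤ ∑ i ∈ l.1.support, l.1 i := Finset.sum_le_sum_of_subset this

lemma finsum_row (B : Finset Partition') (e : ℕ) (f : Partition' → ℕ)
    (h : ∀ x, f x ≠ 0 → ∃ x' ∈ B, x = x' + row e) :
    ∑ᶠ x, f x = ∑ x ∈ B, f (x + row e) := by
  rw [finsum_eq_sum_of_support_subset (s := B.image (fun x => x + row e))]
  · rw [Finset.sum_image]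
    intro x _ y _ hxy
    exact add_row_inj hxy
  · intro x hx
    obtain ⟨x', hx', rfl⟩ := h x hx
    exact Finset.mem_coe.2 (Finset.mem_image_of_mem _ hx')

lemma aguiar_EC (l m nu : Partition') (D : ℕ) (hD : D = 4 * (size l + size m + size nu)) :
    EC fun e => aguiar (l + row D + row e) (m + row D + row e) (nu + row D + row e) := by
  set M := 5 * (size l + size m + size nu) with hM
  set B : Finset Partition' := (finite_size_le M).toFinset with hB
  have memB : ∀ x, x ∈ B ↔ size x ≤ M := by
    intro x
    simp [hB]
  have hdec : ∀ (x : Partition') (e : ℕ), x.1 1 + e ≤ x.1 0 → size x ≤ M + e →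
      ∃ x' ∈ B, x = x' + row e := by
    intro x e h1 h2
    obtain ⟨x', rfl⟩ := exists_sub_row x e h1
    rw [size_add_row] at h2
    exact ⟨x', (memB _).2 (by omega), rfl⟩
  have hdec0 : ∀ (x : Partition'), size x ≤ M → ∃ x' ∈ B, x = x' + row 0 := by
    intro x h
    exact ⟨x, (memB _).2 h, (add_row_zero x).symm⟩
  have main : ∀ e α β δ η ρ τ, lr α β (l + row D + row e) * lr η ρ (m + row D + row e) *
      kron β η δ * lr α δ τ * lr τ ρ (nu + row D + row e) ≠ 0 →
      (∃ x ∈ B, α = x + row 0) ∧ (∃ x ∈ B, β = x + row e) ∧ (∃ x ∈ B, δ = x + row e) ∧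
      (∃ x ∈ B, η = x + row e) ∧ (∃ x ∈ B, ρ = x + row 0) ∧ (∃ x ∈ B, τ = x + row e) := by
    intro e α β δ η ρ τ h
    simp only [mul_ne_zero_iff] at h
    obtain ⟨⟨⟨⟨h1, h2⟩, h3⟩, h4⟩, h5⟩ := h
    have s1 := lr_size h1
    have s2 := lr_size h2
    have s3 := kron_size h3
    have s4 := lr_size h4
    have s5 := lr_size h5
    rw [lr_comm] at h2 h5
    have b1 := lr_bound _ _ _ h1
    have b2 := lr_bound _ _ _ h2
    have b4 := lr_bound _ _ _ h4
    have b5 := lr_bound _ _ _ h5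
    simp only [size_add_row, add_row_apply, if_true] at s1 s2 s5 b1 b2 b5
    have t1 := two_le_size β
    have t2 := two_le_size δ
    have t3 := two_le_size η
    have t4 := two_le_size τ
    refine ⟨hdec0 _ ?_, hdec _ _ ?_ ?_, hdec _ _ ?_ ?_, hdec _ _ ?_ ?_, hdec0 _ ?_,
      hdec _ _ ?_ ?_⟩ <;> omega
  have hsum : ∀ e, aguiar (l + row D + row e) (m + row D + row e) (nu + row D + row e) =
      ∑ α ∈ B, ∑ β ∈ B, ∑ δ ∈ B, ∑ η ∈ B, ∑ ρ ∈ B, ∑ τ ∈ B,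
        lr (α + row 0) (β + row e) (l + row D + row e) *
        lr (η + row e) (ρ + row 0) (m + row D + row e) *
        kron (β + row e) (η + row e) (δ + row e) * lr (α + row 0) (δ + row e) (τ + row e) *
        lr (τ + row e) (ρ + row 0) (nu + row D + row e) := by
    intro e
    unfold aguiar
    have E6 := fun α β δ η ρ => finsum_row B e (fun τ => lr α β (l + row D + row e) *
      lr η ρ (m + row D + row e) * kron β η δ * lr α δ τ * lr τ ρ (nu + row D + row e))
      (fun τ h => (main e α β δ η ρ τ h).2.2.2.2.2)
    simp_rw [E6]
    have E5 := fun α β δ η => finsum_row B 0 (fun ρ => ∑ τ ∈ B, lr α β (l + row D + row e) *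
      lr η ρ (m + row D + row e) * kron β η δ * lr α δ (τ + row e) *
      lr (τ + row e) ρ (nu + row D + row e))
      (fun ρ h => by
        obtain ⟨τ, _, h⟩ := Finset.exists_ne_zero_of_sum_ne_zero h
        exact (main e α β δ η ρ _ h).2.2.2.2.1)
    simp_rw [E5]
    have E4 := fun α β δ => finsum_row B e (fun η => ∑ ρ ∈ B, ∑ τ ∈ B,
      lr α β (l + row D + row e) *
      lr η (ρ + row 0) (m + row D + row e) * kron β η δ * lr α δ (τ + row e) *
      lr (τ + row e) (ρ + row 0) (nu + row D + row e))
      (fun η h => by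
        obtain ⟨ρ, _, h⟩ := Finset.exists_ne_zero_of_sum_ne_zero h
        obtain ⟨τ, _, h⟩ := Finset.exists_ne_zero_of_sum_ne_zero h
        exact (main e α β δ η _ _ h).2.2.2.1)
    simp_rw [E4]
    have E3 := fun α β => finsum_row B e (fun δ => ∑ η ∈ B, ∑ ρ ∈ B, ∑ τ ∈ B,
      lr α β (l + row D + row e) *
      lr (η + row e) (ρ + row 0) (m + row D + row e) * kron β (η + row e) δ *
      lr α δ (τ + row e) * lr (τ + row e) (ρ + row 0) (nu + row D + row e))
      (fun δ h => by
        obtain ⟨η, _, h⟩ := Finset.exists_ne_zero_of_sum_ne_zero h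
        obtain ⟨ρ, _, h⟩ := Finset.exists_ne_zero_of_sum_ne_zero h
        obtain ⟨τ, _, h⟩ := Finset.exists_ne_zero_of_sum_ne_zero h
        exact (main e α β δ _ _ _ h).2.2.1)
    simp_rw [E3]
    have E2 := fun α => finsum_row B e (fun β => ∑ δ ∈ B, ∑ η ∈ B, ∑ ρ ∈ B, ∑ τ ∈ B,
      lr α β (l + row D + row e) *
      lr (η + row e) (ρ + row 0) (m + row D + row e) * kron β (η + row e) (δ + row e) *
      lr α (δ + row e) (τ + row e) * lr (τ + row e) (ρ + row 0) (nu + row D + row e))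
      (fun β h => by
        obtain ⟨δ, _, h⟩ := Finset.exists_ne_zero_of_sum_ne_zero h
        obtain ⟨η, _, h⟩ := Finset.exists_ne_zero_of_sum_ne_zero h
        obtain ⟨ρ, _, h⟩ := Finset.exists_ne_zero_of_sum_ne_zero h
        obtain ⟨τ, _, h⟩ := Finset.exists_ne_zero_of_sum_ne_zero h
        exact (main e α β _ _ _ _ h).2.1)
    simp_rw [E2]
    exact finsum_row B 0 (fun α => ∑ β ∈ B, ∑ δ ∈ B, ∑ η ∈ B, ∑ ρ ∈ B, ∑ τ ∈ B,
      lr α (β + row e) (l + row D + row e) *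
      lr (η + row e) (ρ + row 0) (m + row D + row e) *
      kron (β + row e) (η + row e) (δ + row e) *
      lr α (δ + row e) (τ + row e) * lr (τ + row e) (ρ + row 0) (nu + row D + row e))
      (fun α h => by
        obtain ⟨β, _, h⟩ := Finset.exists_ne_zero_of_sum_ne_zero h
        obtain ⟨δ, _, h⟩ := Finset.exists_ne_zero_of_sum_ne_zero h
        obtain ⟨η, _, h⟩ := Finset.exists_ne_zero_of_sum_ne_zero h
        obtain ⟨ρ, _, h⟩ := Finset.exists_ne_zero_of_sum_ne_zero h
        obtain ⟨τ, _, h⟩ := Finset.exists_ne_zero_of_sum_ne_zero h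
        exact (main e α _ _ _ _ _ h).1)
  refine EC.congr ?_ hsum
  refine EC.sum _ _ fun α _ => EC.sum _ _ fun β _ => EC.sum _ _ fun δ _ => EC.sum _ _ fun η _ =>
    EC.sum _ _ fun ρ _ => EC.sum _ _ fun τ _ => ?_
  refine EC.map₂ (· * ·) (EC.map₂ (· * ·) (EC.map₂ (· * ·) (EC.map₂ (· * ·)
    (lr_EC _ _ _) ?_) (kron_EC _ _ _)) (lr_EC _ _ _)) ?_
  · exact (lr_EC (ρ + row 0) η (m + row D)).congr fun e => lr_comm _ _ _
  · exact (lr_EC (ρ + row 0) τ (nu + row D)).congr fun e => lr_comm _ _ _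

end Partition'

open Partition' in
/-- For all partitions `λ, μ, ν`, the sequence `d ↦ a_{λ+(d),μ+(d)}^{ν+(d)}` is eventually
constant, where `λ+(d)` adds `d` to the first part of `λ`. -/
theorem aguiar_eventually_constant (l m nu : Partition') :
    ∃ N : ℕ, ∀ d : ℕ, N ≤ d →
      aguiar (l + row d) (m + row d) (nu + row d) =
        aguiar (l + row N) (m + row N) (nu + row N) := by
  obtain ⟨c, hc⟩ := aguiar_EC l m nu _ rfl
  obtain ⟨N, hN⟩ := Filter.eventually_atTop.1 hc
  refine ⟨4 * (size l + size m + size nu) + N, fun d hd => ?_⟩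
  obtain ⟨k, rfl⟩ := Nat.exists_eq_add_of_le hd
  rw [add_assoc]
  simp only [add_row_add _ (4 * (size l + size m + size nu))]
  exact (hN (N + k) (by omega)).trans (hN N le_rfl).symm
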